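/- Let σ > 0, σ ≠ 1, and w > 0 be real numbers. Then ζ(σ, w) = (1 − σ − w)/((1 − σ) w^{σ}) + lim_{N→∞} λ_N, where λ_N = ∑_{n=1}^{N} ( (n + w)^{−σ} − ∫_{n−1}^{n} (x + w)^{−σ} dx ). -/

import Mathlib

open Filter Topology

/-- The standard Hurwitz zeta function `ζ(s, w)` for real `w > 0`: the meromorphic continuation
of `∑_{n=0}^∞ (n + w)^{-s}`, expressed via Mathlib's (periodic in `a`) Hurwitz zeta function by
removing the first `⌈w⌉ - 1` terms of the series with parameter `w - (⌈w⌉ - 1) ∈ (0, 1]`. -/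
noncomputable def stdHurwitzZeta (s : ℂ) (w : ℝ) : ℂ :=
  HurwitzZeta.hurwitzZeta (w : UnitAddCircle) s -
    ∑ n ∈ Finset.range (⌈w⌉₊ - 1), (((n : ℝ) + (w - (⌈w⌉₊ - 1 : ℕ))) : ℂ) ^ (-s)

/-- The Euler–Maclaurin error term `λ_N = ∑_{n=1}^N ((n+w)^{-σ} - ∫_{n-1}^n (x+w)^{-σ} dx)`. -/
noncomputable def lambdaSeq (σ w : ℝ) (N : ℕ) : ℝ :=
  ∑ n ∈ Finset.Icc 1 N,
    (((n : ℝ) + w) ^ (-σ) - ∫ x in ((n : ℝ) - 1)..(n : ℝ), (x + w) ^ (-σ))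

/-- The complex Euler–Maclaurin error term
`(n + 1 + w)^{-s} - ∫_n^{n+1} (x + w)^{-s} dx`, with the integral evaluated. -/
noncomputable def eulerMaclaurinTerm (w : ℝ) (n : ℕ) (s : ℂ) : ℂ :=
  ((n + 1 + w : ℝ) : ℂ) ^ (-s) -
    (((n + 1 + w : ℝ) : ℂ) ^ (1 - s) - ((n + w : ℝ) : ℂ) ^ (1 - s)) / (1 - s)

theorem differentiableAt_ofReal_cpow {x : ℝ} (hx : 0 < x) {f : ℂ → ℂ} {s : ℂ}
    (hf : DifferentiableAt ℂ f s) : DifferentiableAt ℂ (fun z => (x : ℂ) ^ f z) s :=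
  hf.const_cpow (Or.inl (by exact_mod_cast hx.ne'))

theorem differentiableAt_eulerMaclaurinTerm {w : ℝ} (hw : 0 < w) (n : ℕ) {s : ℂ} (hs : s ≠ 1) :
    DifferentiableAt ℂ (eulerMaclaurinTerm w n) s := by
  have h1 : (0 : ℝ) < n + 1 + w := by positivity
  have h2 : (0 : ℝ) < n + w := by positivity
  have h3 : DifferentiableAt ℂ (fun z : ℂ => 1 - z) s := by fun_prop
  exact (differentiableAt_ofReal_cpow h1 (by fun_prop)).sub
    (((differentiableAt_ofReal_cpow h1 h3).sub (differentiableAt_ofReal_cpow h2 h3)).div h3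
      (sub_ne_zero.mpr hs.symm))

theorem norm_eulerMaclaurinTerm_le {w : ℝ} (hw : 0 < w) (n : ℕ) {s : ℂ} (hs : s ≠ 1)
    (hs0 : 0 < s.re) :
    ‖eulerMaclaurinTerm w n s‖ ≤ ‖s‖ * (n + w) ^ (-s.re - 1) := by
  have hs1 : 1 - s ≠ 0 := sub_ne_zero.mpr hs.symm
  have hnw : (0 : ℝ) < n + w := by positivity
  let f : ℝ → ℂ := fun y => ((y : ℂ) - (n + w : ℝ)) * (y : ℂ) ^ (-s) - (y : ℂ) ^ (1 - s) / (1 - s)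
  let f' : ℝ → ℂ := fun y => ((y : ℂ) - (n + w : ℝ)) * (-s * (y : ℂ) ^ (-s - 1))
  have hf : ∀ y ∈ Set.Icc (n + w : ℝ) (n + w + 1),
      HasDerivWithinAt f (f' y) (Set.Icc (n + w : ℝ) (n + w + 1)) y := by
    intro y hy
    have hy0 : 0 < y := hnw.trans_le hy.1
    have hslit : (y : ℂ) ∈ Complex.slitPlane := Complex.ofReal_mem_slitPlane.mpr hy0
    have h1 : HasDerivAt (fun z : ℂ => z ^ (-s)) (-s * (y : ℂ) ^ (-s - 1)) y := by
      simpa using (hasDerivAt_id (y : ℂ)).cpow_const (c := -s) hslit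
    have h2 : HasDerivAt (fun z : ℂ => z ^ (1 - s)) ((1 - s) * (y : ℂ) ^ (-s)) y := by
      simpa using (hasDerivAt_id (y : ℂ)).cpow_const (c := 1 - s) hslit
    have h3 := ((((hasDerivAt_id (y : ℂ)).sub_const ((n + w : ℝ) : ℂ)).mul h1).sub
      (h2.div_const (1 - s))).comp_ofReal
    refine (h3.congr_deriv ?_).hasDerivWithinAt
    simp only [f', id]
    field_simp
    ring
  have hbound : ∀ y ∈ Set.Ico (n + w : ℝ) (n + w + 1),
      ‖f' y‖ ≤ ‖s‖ * (n + w) ^ (-s.re - 1) := by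
    intro y hy
    have hy0 : 0 < y := hnw.trans_le hy.1
    have h1 : ‖(y : ℂ) - (n + w : ℝ)‖ ≤ 1 := by
      rw [← Complex.ofReal_sub, Complex.norm_real, Real.norm_eq_abs, abs_le]
      constructor <;> linarith [hy.1, hy.2]
    have h2 : ‖(y : ℂ) ^ (-s - 1)‖ ≤ (n + w) ^ (-s.re - 1) := by
      rw [Complex.norm_cpow_eq_rpow_re_of_pos hy0]
      simpa using Real.rpow_le_rpow_of_nonpos hnw hy.1 (by linarith : -s.re - 1 ≤ 0)
    calc ‖f' y‖ = ‖(y : ℂ) - (n + w : ℝ)‖ * (‖s‖ * ‖(y : ℂ) ^ (-s - 1)‖) := by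
          simp only [f', norm_mul, norm_neg]
      _ ≤ 1 * (‖s‖ * (n + w) ^ (-s.re - 1)) := by gcongr
      _ = _ := one_mul _
  have key := norm_image_sub_le_of_norm_deriv_le_segment' hf hbound (n + w + 1) (by simp)
  have heq : f (n + w + 1) - f (n + w) = eulerMaclaurinTerm w n s := by
    simp only [f, eulerMaclaurinTerm, add_right_comm (n : ℝ) 1 w]
    push_cast
    ring
  rw [heq] at key
  simpa using key

theorem summable_natCast_add_rpow {w : ℝ} (hw : 0 < w) {r : ℝ} (hr : r < -1) :
    Summable fun n : ℕ => (n + w : ℝ) ^ r := by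
  refine ((Real.summable_one_div_nat_add_rpow w (-r)).mpr (by linarith)).congr fun n => ?_
  have h : (0 : ℝ) < n + w := by positivity
  rw [abs_of_pos h, Real.rpow_neg h.le, one_div, inv_inv]

theorem summable_eulerMaclaurinTerm {w : ℝ} (hw : 0 < w) {s : ℂ} (hs : s ≠ 1) (hs0 : 0 < s.re) :
    Summable fun n => eulerMaclaurinTerm w n s :=
  .of_norm_bounded ((summable_natCast_add_rpow hw (by linarith)).mul_left ‖s‖)
    fun n => norm_eulerMaclaurinTerm_le hw n hs hs0

theorem differentiableAt_tsum_eulerMaclaurinTerm {w : ℝ} (hw : 0 < w) {s : ℂ} (hs : s ≠ 1)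
    (hs0 : 0 < s.re) :
    DifferentiableAt ℂ (fun z => ∑' n, eulerMaclaurinTerm w n z) s := by
  obtain ⟨δ, hδ0, hδ⟩ := exists_between hs0
  obtain ⟨R, hR⟩ := exists_gt ‖s‖
  let V : Set ℂ := {z | δ < z.re} ∩ {z | ‖z‖ < R} ∩ {1}ᶜ
  have hV : IsOpen V :=
    ((isOpen_lt continuous_const Complex.continuous_re).inter
      (isOpen_lt continuous_norm continuous_const)).inter isOpen_compl_singleton
  set m := min w 1
  have hm : 0 < m := lt_min hw one_pos
  have hsum : Summable fun n : ℕ => R * ((n + w : ℝ) ^ (-δ - 1) * m ^ (-R)) :=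
    ((summable_natCast_add_rpow hw (by linarith)).mul_right _).mul_left _
  refine (Complex.differentiableOn_tsum_of_summable_norm hsum (fun n z hz =>
    (differentiableAt_eulerMaclaurinTerm hw n hz.2).differentiableWithinAt) hV
    (fun n z hz => ?_)).differentiableAt (hV.mem_nhds ⟨⟨hδ, hR⟩, hs⟩)
  obtain ⟨⟨hz1, hz2⟩, hz3⟩ := hz
  simp only [Set.mem_ofPred_eq] at hz1 hz2
  have hR0 : 0 ≤ R := (norm_nonneg s).trans hR.le
  have hnw : (0 : ℝ) < n + w := by positivity
  have hmn : m ≤ n + w := (min_le_left w 1).trans (by simp)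
  refine (norm_eulerMaclaurinTerm_le hw n hz3 (hδ0.trans hz1)).trans ?_
  have h1 : (n + w : ℝ) ^ (-z.re - 1) = (n + w) ^ (-δ - 1) * (n + w) ^ (δ - z.re) := by
    rw [← Real.rpow_add hnw]
    ring_nf
  have h2 : (n + w : ℝ) ^ (δ - z.re) ≤ m ^ (-R) :=
    (Real.rpow_le_rpow_of_nonpos hm hmn (by linarith)).trans
      (Real.rpow_le_rpow_of_exponent_ge hm (min_le_right w 1)
        (by linarith [Complex.re_le_norm z]))
  rw [h1]
  gcongr

theorem sum_range_eulerMaclaurinTerm (w : ℝ) (s : ℂ) (N : ℕ) :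
    ∑ n ∈ Finset.range N, eulerMaclaurinTerm w n s =
      ∑ n ∈ Finset.range (N + 1), ((n + w : ℝ) : ℂ) ^ (-s) - (w : ℂ) ^ (-s) -
        (((N + w : ℝ) : ℂ) ^ (1 - s) - (w : ℂ) ^ (1 - s)) / (1 - s) := by
  have h := Finset.sum_range_sub (fun n : ℕ => ((n + w : ℝ) : ℂ) ^ (1 - s)) N
  simp only [Nat.cast_add, Nat.cast_one, Nat.cast_zero, zero_add] at h
  simp only [eulerMaclaurinTerm]
  rw [Finset.sum_sub_distrib, ← Finset.sum_div, h, Finset.sum_range_succ']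
  simp

theorem hasSum_stdHurwitzZeta {w : ℝ} (hw : 0 < w) {s : ℂ} (hs : 1 < s.re) :
    HasSum (fun n : ℕ => ((n + w : ℝ) : ℂ) ^ (-s)) (stdHurwitzZeta s w) := by
  set k : ℕ := ⌈w⌉₊ - 1 with hk
  have hk1 : k + 1 = ⌈w⌉₊ := Nat.sub_add_cancel (Nat.one_le_ceil_iff.mpr hw)
  have hkw : (k : ℝ) < w := Nat.lt_ceil.mp (by lia)
  have hwk : w ≤ k + 1 := by
    have := Nat.le_ceil w
    rw [← hk1] at this
    exact_mod_cast this
  have hcoe : ((w - k : ℝ) : UnitAddCircle) = (w : UnitAddCircle) := by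
    rw [AddCircle.coe_sub, sub_eq_self, AddCircle.coe_eq_zero_iff]
    exact ⟨k, by simp⟩
  have h := HurwitzZeta.hasSum_hurwitzZeta_of_one_lt_re (a := w - k)
    ⟨by linarith, by linarith⟩ hs
  rw [hcoe, ← hasSum_nat_add_iff' k] at h
  have hterm (n : ℕ) :
      1 / ((n + k : ℕ) + ((w - k : ℝ) : ℂ)) ^ s = ((n + w : ℝ) : ℂ) ^ (-s) := by
    rw [Complex.cpow_neg, one_div]
    push_cast
    ring_nf
  simp only [hterm] at h
  suffices heq : HurwitzZeta.hurwitzZeta (w : UnitAddCircle) s -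
      ∑ n ∈ Finset.range k, 1 / ((n : ℂ) + ((w - k : ℝ) : ℂ)) ^ s = stdHurwitzZeta s w from heq ▸ h
  rw [stdHurwitzZeta, ← hk]
  refine congrArg _ (Finset.sum_congr rfl fun n _ => ?_)
  rw [Complex.cpow_neg, one_div]
  push_cast
  rfl

theorem tendsto_natCast_add_cpow_zero (w : ℝ) {s : ℂ} (hs : s.re < 0) :
    Tendsto (fun n : ℕ => ((n + w : ℝ) : ℂ) ^ s) atTop (𝓝 0) := by
  have hlim : Tendsto (fun n : ℕ => (n + w : ℝ)) atTop atTop :=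
    tendsto_atTop_add_const_right _ _ tendsto_natCast_atTop_atTop
  rw [tendsto_zero_iff_norm_tendsto_zero]
  have h := (tendsto_rpow_neg_atTop (neg_pos.mpr hs)).comp hlim
  refine h.congr' ?_
  filter_upwards [hlim.eventually_gt_atTop 0] with n hn
  rw [Complex.norm_cpow_eq_rpow_re_of_pos hn, Function.comp_apply, neg_neg]

theorem tsum_eulerMaclaurinTerm_of_one_lt_re {w : ℝ} (hw : 0 < w) {s : ℂ} (hs : 1 < s.re) :
    ∑' n, eulerMaclaurinTerm w n s =
      stdHurwitzZeta s w - (w : ℂ) ^ (-s) + (w : ℂ) ^ (1 - s) / (1 - s) := by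
  have hs1 : s ≠ 1 := by
    rintro rfl
    simp at hs
  have h1 := (summable_eulerMaclaurinTerm hw hs1 (one_pos.trans hs)).hasSum.tendsto_sum_nat
  have h2 := (tendsto_add_atTop_iff_nat 1).mpr (hasSum_stdHurwitzZeta hw hs).tendsto_sum_nat
  have h3 := tendsto_natCast_add_cpow_zero w (s := 1 - s) (by simpa using hs)
  refine tendsto_nhds_unique h1 ?_
  simp only [sum_range_eulerMaclaurinTerm]
  convert (h2.sub_const ((w : ℂ) ^ (-s))).sub
    ((h3.sub_const ((w : ℂ) ^ (1 - s))).div_const (1 - s)) using 2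
  ring

theorem isPreconnected_re_pos_diff_one : IsPreconnected ({s : ℂ | 0 < s.re} \ {1}) := by
  have hup := ((convex_halfSpace_re_gt 0).inter (convex_halfSpace_im_gt 0)).isPreconnected
  have hdown := ((convex_halfSpace_re_gt 0).inter (convex_halfSpace_im_lt 0)).isPreconnected
  have hleft := ((convex_halfSpace_re_gt 0).inter (convex_halfSpace_re_lt 1)).isPreconnected
  have hright := (convex_halfSpace_re_gt 1).isPreconnected
  have h1 := hup.union (2 + Complex.I) (by simp) (by simp) hright
  have h2 := h1.union (2 - Complex.I) (by simp) (by simp) hdown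
  have h3 := h2.union (1 / 2 + Complex.I) (by simp) (by norm_num) hleft
  convert h3 using 1
  ext s
  simp only [Set.mem_sdiff, Set.mem_ofPred_eq, Set.mem_singleton_iff, Set.mem_union,
    Set.mem_inter_iff, Complex.ext_iff, Complex.one_re, Complex.one_im]
  grind

theorem differentiableAt_stdHurwitzZeta {w : ℝ} (hw : 0 < w) {s : ℂ} (hs : s ≠ 1) :
    DifferentiableAt ℂ (fun z => stdHurwitzZeta z w) s := by
  have hkw : ((⌈w⌉₊ - 1 : ℕ) : ℝ) < w :=
    Nat.lt_ceil.mp (Nat.sub_lt (Nat.ceil_pos.mpr hw) one_pos)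
  refine (HurwitzZeta.differentiableAt_hurwitzZeta _ hs).sub (.fun_sum fun n _ => ?_)
  have h : (0 : ℝ) < n + (w - (⌈w⌉₊ - 1 : ℕ)) := by
    have := sub_pos.mpr hkw
    positivity
  simpa using differentiableAt_ofReal_cpow h (differentiableAt_id (𝕜 := ℂ) (x := s)).neg

theorem tsum_eulerMaclaurinTerm {w : ℝ} (hw : 0 < w) {s : ℂ} (hs : s ≠ 1) (hs0 : 0 < s.re) :
    ∑' n, eulerMaclaurinTerm w n s =
      stdHurwitzZeta s w - (w : ℂ) ^ (-s) + (w : ℂ) ^ (1 - s) / (1 - s) := by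
  have hU : IsOpen ({s : ℂ | 0 < s.re} \ {1}) :=
    (isOpen_lt continuous_const Complex.continuous_re).sdiff isClosed_singleton
  refine AnalyticOnNhd.eqOn_of_preconnected_of_eventuallyEq
    (f := fun z => ∑' n, eulerMaclaurinTerm w n z)
    (g := fun z => stdHurwitzZeta z w - (w : ℂ) ^ (-z) + (w : ℂ) ^ (1 - z) / (1 - z))
    (z₀ := 2) (DifferentiableOn.analyticOnNhd (fun z hz => ?_) hU)
    (DifferentiableOn.analyticOnNhd (fun z hz => ?_) hU)
    isPreconnected_re_pos_diff_one (by simp) ?_ ⟨hs0, hs⟩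
  · exact (differentiableAt_tsum_eulerMaclaurinTerm hw hz.2 hz.1).differentiableWithinAt
  · have h : DifferentiableAt ℂ (fun z : ℂ => 1 - z) z := by fun_prop
    exact (((differentiableAt_stdHurwitzZeta hw hz.2).sub
      (differentiableAt_ofReal_cpow hw (by fun_prop))).add
      ((differentiableAt_ofReal_cpow hw h).div h
        (sub_ne_zero.mpr (Ne.symm hz.2)))).differentiableWithinAt
  · filter_upwards [(isOpen_lt continuous_const Complex.continuous_re).mem_nhds
      (show (1 : ℝ) < (2 : ℂ).re by simp)] with z hz
    exact tsum_eulerMaclaurinTerm_of_one_lt_re hw hz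

theorem ofReal_lambdaSeq {σ w : ℝ} (hσ1 : σ ≠ 1) (hw : 0 < w) (N : ℕ) :
    (lambdaSeq σ w N : ℂ) = ∑ n ∈ Finset.range N, eulerMaclaurinTerm w n σ := by
  rw [lambdaSeq, ← Finset.Ico_add_one_right_eq_Icc, Finset.sum_Ico_eq_sum_range,
    Complex.ofReal_sum]
  refine Finset.sum_congr (by simp) fun n _ => ?_
  have h1 : (0 : ℝ) < n + 1 + w := by positivity
  have h2 : (0 : ℝ) < n + w := by positivity
  have hint : ∫ x in (n : ℝ)..(n + 1), (x + w) ^ (-σ) =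
      ((n + 1 + w) ^ (1 - σ) - (n + w) ^ (1 - σ)) / (1 - σ) := by
    rw [intervalIntegral.integral_comp_add_right (fun x => x ^ (-σ)), integral_rpow]
    · ring_nf
    · exact .inr ⟨by simpa [neg_eq_iff_eq_neg] using hσ1,
        Set.notMem_uIcc_of_lt h2 h1⟩
  have hcast : ((1 + n : ℕ) : ℝ) = n + 1 := by
    push_cast
    ring
  rw [hcast, add_sub_cancel_right, hint, eulerMaclaurinTerm]
  push_cast [Complex.ofReal_cpow h1.le, Complex.ofReal_cpow h2.le]
  rfl

/-- For real `σ > 0`, `σ ≠ 1`, `w > 0`: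
`ζ(σ, w) = (1-σ-w)/((1-σ) w^σ) + lim_{N → ∞} λ_N`. -/
theorem hurwitzZeta_eq_bound_add_lim_lambdaSeq (σ w : ℝ) (hσ : 0 < σ) (hσ1 : σ ≠ 1)
    (hw : 0 < w) :
    ∃ l : ℝ, Tendsto (lambdaSeq σ w) atTop (𝓝 l) ∧
      stdHurwitzZeta (σ : ℂ) w = (((1 - σ - w) / ((1 - σ) * w ^ σ) + l : ℝ) : ℂ) := by
  have hs : (σ : ℂ) ≠ 1 := by exact_mod_cast hσ1
  have hlim : Tendsto (fun N => (lambdaSeq σ w N : ℂ)) atTop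
      (𝓝 (∑' n, eulerMaclaurinTerm w n σ)) := by
    simp only [ofReal_lambdaSeq hσ1 hw]
    exact (summable_eulerMaclaurinTerm hw hs (by simpa using hσ)).hasSum.tendsto_sum_nat
  have hre : Tendsto (lambdaSeq σ w) atTop (𝓝 (∑' n, eulerMaclaurinTerm w n σ).re) := by
    exact (Complex.continuous_re.tendsto _).comp hlim
  refine ⟨_, hre, ?_⟩
  have hreal := tendsto_nhds_unique hlim ((Complex.continuous_ofReal.tendsto _).comp hre)
  rw [Complex.ofReal_add, ← hreal, tsum_eulerMaclaurinTerm hw hs (by simpa using hσ)]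
  have h1 : (1 - σ) ≠ 0 := sub_ne_zero.mpr hσ1.symm
  have hreal_eq : (1 - σ - w) / ((1 - σ) * w ^ σ) = w ^ (-σ) - w ^ (1 - σ) / (1 - σ) := by
    have := (Real.rpow_pos_of_pos hw σ).ne'
    rw [Real.rpow_sub hw, Real.rpow_neg hw.le, Real.rpow_one]
    field_simp
  rw [hreal_eq]
  push_cast [Complex.ofReal_cpow hw.le]
  ring
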